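/- Let F be a field, n a positive integer with (n+1 : F) ≠ 0, and let P be the (n+1)×(n+1) matrix over F having first row all 1's and, for 2 ≤ k ≤ n+1, row k with P_{k,n+1} = 1, P_{k,n+2−k} = −1 and zeros elsewhere (P is invertible). Then the map f(a) := P*a*P⁻¹ is a bijection from the set of (n+1)×(n+1) matrices of block form with upper-left n×n block A satisfying trace(A) = −1, zero last row and last column except the (n+1,n+1) entry equal to 1, onto the set sna(n,F) of (n+1)×(n+1) matrices all of whose row sums and column sums equal 1 and whose trace is 0; moreover f preserves the affine commutator bracket: f(a*b − b*a + b) = f(a)*f(b) − f(b)*f(a) + f(b). -/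

import Mathlib

open Matrix BigOperators

/-- The matrix `P`: first row (index 0) all `1`'s; for rows `i ≥ 1`, the entry in the
last column is `1`, the entry in column `n - i` is `-1`, and all other entries are `0`.
(1-based: `P_{1,l} = 1`, and for `2 ≤ k ≤ n+1`: `P_{k,n+1} = 1`, `P_{k,n+2-k} = -1`.) -/
def Pmat (F : Type*) [Field F] (n : ℕ) : Matrix (Fin (n + 1)) (Fin (n + 1)) F :=
  Matrix.of fun i j =>
    if (i : ℕ) = 0 then 1
    else if (j : ℕ) = n then 1
    else if (i : ℕ) + (j : ℕ) = n then -1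
    else 0

/-- The matrix `Q`: last row (index n) all `1`'s; for rows `i ≤ n - 1`, the entry in
column `n - i` is `-n` and all other entries are `1`.
(1-based: `Q_{n+1,l} = 1`, and for `1 ≤ k ≤ n`: `Q_{k,n+2-k} = -n`, `Q_{k,l} = 1` otherwise.) -/
def Qmat (F : Type*) [Field F] (n : ℕ) : Matrix (Fin (n + 1)) (Fin (n + 1)) F :=
  Matrix.of fun i j =>
    if (i : ℕ) = n then 1
    else if (i : ℕ) + (j : ℕ) = n then -(n : F)
    else 1

lemma Pmat_apply (F : Type*) [Field F] (n : ℕ) (i j : Fin (n + 1)) :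
    Pmat F n i j = (if i = 0 then 1 else 0) + (if j = Fin.last n then 1 else 0)
      - (if j = i.rev then 1 else 0) := by
  simp only [Pmat, Matrix.of_apply, Fin.ext_iff, Fin.val_rev, Fin.val_last, Fin.val_zero]
  split_ifs <;> first | omega | simp

lemma Pmat_mulVec (F : Type*) [Field F] (n : ℕ) (v : Fin (n + 1) → F) (i : Fin (n + 1)) :
    (Pmat F n *ᵥ v) i = (if i = 0 then ∑ j, v j else 0) + v (Fin.last n) - v i.rev := by
  simp only [Matrix.mulVec, dotProduct, Pmat_apply, sub_mul, add_mul, Finset.sum_sub_distrib,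
    Finset.sum_add_distrib, ite_mul, one_mul, zero_mul, Finset.sum_ite_eq', Finset.mem_univ,
    if_true]
  split_ifs <;> simp

lemma Pmat_mulVec_single_last (F : Type*) [Field F] (n : ℕ) :
    Pmat F n *ᵥ Pi.single (Fin.last n) 1 = 1 := by
  ext i
  rw [Matrix.mulVec_single_one]
  simp [Pmat_apply, Matrix.col, ← Fin.rev_zero, eq_comm]

lemma one_vecMul_Pmat (F : Type*) [Field F] (n : ℕ) :
    1 ᵥ* Pmat F n = Pi.single (Fin.last n) ((n : F) + 1) := by
  ext j
  simp [Matrix.vecMul, dotProduct, Pmat_apply, Finset.sum_sub_distrib, Finset.sum_add_distrib,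
    Pi.single_apply, ← Fin.rev_eq_iff]

lemma isUnit_Pmat_det (F : Type*) [Field F] (n : ℕ) (hchar : (n : F) + 1 ≠ 0) :
    IsUnit (Pmat F n).det := by
  rw [← Matrix.isUnit_iff_isUnit_det, ← Matrix.mulVec_injective_iff_isUnit]
  refine (injective_iff_map_eq_zero (Pmat F n).mulVecLin).2 fun v hv => ?_
  replace hv : Pmat F n *ᵥ v = 0 := hv
  have hconst (j : Fin (n + 1)) : v j = v (Fin.last n) := by
    by_cases hj : j = Fin.last n
    · rw [hj]
    · have h := congrFun hv j.rev
      rw [Pmat_mulVec, if_neg (by rwa [Fin.rev_eq_iff, Fin.rev_zero]), Fin.rev_rev, zero_add] at h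
      exact (sub_eq_zero.1 h).symm
  have h := congrFun hv 0
  rw [Pmat_mulVec, if_pos rfl, Fin.rev_zero, add_sub_cancel_right,
    Finset.sum_congr rfl fun j _ => hconst j] at h
  have hlast : v (Fin.last n) = 0 := by simpa [hchar] using h
  ext j
  rw [hconst, hlast, Pi.zero_apply]

/-- The block condition says that the last basis vector is fixed by `a` on both sides and that
`a` has trace `0`. -/
lemma block_iff_fix_single_last {F : Type*} [Field F] {n : ℕ}
    (a : Matrix (Fin (n + 1)) (Fin (n + 1)) F) :
    (a (Fin.last n) (Fin.last n) = 1 ∧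
      (∀ j, j ≠ Fin.last n → a (Fin.last n) j = 0 ∧ a j (Fin.last n) = 0) ∧
      ∑ k : Fin n, a (Fin.castSucc k) (Fin.castSucc k) = -1) ↔
    a *ᵥ Pi.single (Fin.last n) 1 = Pi.single (Fin.last n) 1 ∧
      Pi.single (Fin.last n) 1 ᵥ* a = Pi.single (Fin.last n) 1 ∧ a.trace = 0 := by
  simp only [Matrix.mulVec_single_one, Matrix.single_one_vecMul, funext_iff, Matrix.col_apply,
    Matrix.row_apply, Matrix.trace, Matrix.diag_apply, Fin.sum_univ_castSucc]
  constructor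
  · rintro ⟨h1, h2, h3⟩
    refine ⟨fun i => ?_, fun i => ?_, by rw [h3, h1, neg_add_cancel]⟩ <;>
    · by_cases hi : i = Fin.last n
      · simp [hi, h1]
      · simp [hi, h2 i hi]
  · rintro ⟨h1, h2, h3⟩
    have h := h1 (Fin.last n)
    rw [Pi.single_eq_same] at h
    refine ⟨h, fun j hj => ⟨by simpa [hj] using h2 j, by simpa [hj] using h1 j⟩, ?_⟩
    rwa [h, add_eq_zero_iff_eq_neg] at h3

lemma row_col_sums_eq_one_iff {F : Type*} [Field F] {n : ℕ}
    (a : Matrix (Fin (n + 1)) (Fin (n + 1)) F) :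
    ((∀ l, ∑ k, a l k = 1) ∧ (∀ l, ∑ k, a k l = 1) ∧ a.trace = 0) ↔
    a *ᵥ 1 = 1 ∧ 1 ᵥ* a = 1 ∧ a.trace = 0 := by
  simp [funext_iff, Matrix.mulVec, Matrix.vecMul, dotProduct]

/-- Conjugation by `P` carries the fixed vectors `e_{n+1}` to the all-ones vectors. -/
lemma Pmat_conj_fix_iff {F : Type*} [Field F] {n : ℕ} (hchar : (n : F) + 1 ≠ 0)
    (a : Matrix (Fin (n + 1)) (Fin (n + 1)) F) :
    ((Pmat F n * a * (Pmat F n)⁻¹) *ᵥ 1 = 1 ∧ 1 ᵥ* (Pmat F n * a * (Pmat F n)⁻¹) = 1 ∧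
      (Pmat F n * a * (Pmat F n)⁻¹).trace = 0) ↔
    a *ᵥ Pi.single (Fin.last n) 1 = Pi.single (Fin.last n) 1 ∧
      Pi.single (Fin.last n) 1 ᵥ* a = Pi.single (Fin.last n) 1 ∧ a.trace = 0 := by
  have hP := isUnit_Pmat_det F n hchar
  have hU := (Matrix.isUnit_iff_isUnit_det _).2 hP
  have hinj := Matrix.mulVec_injective_iff_isUnit.2 hU
  have hinj' := Matrix.vecMul_injective_iff_isUnit.2 hU
  have hsingle : Pi.single (Fin.last n) ((n : F) + 1) =
      ((n : F) + 1) • Pi.single (Fin.last n) (1 : F) := by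
    rw [← Pi.single_smul, smul_eq_mul, mul_one]
  refine and_congr ?_ (and_congr ?_ ?_)
  · rw [← Pmat_mulVec_single_last, Matrix.mulVec_mulVec, Matrix.nonsing_inv_mul_cancel_right _ _ hP,
      ← Matrix.mulVec_mulVec, hinj.eq_iff]
  · rw [← hinj'.eq_iff, Matrix.vecMul_vecMul, Matrix.nonsing_inv_mul_cancel_right _ _ hP,
      ← Matrix.vecMul_vecMul, one_vecMul_Pmat, hsingle, Matrix.smul_vecMul]
    exact (smul_right_injective _ hchar).eq_iff
  · rw [Matrix.trace_mul_cycle, Matrix.nonsing_inv_mul _ hP, one_mul]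

/-- If `n + 1 ≠ 0` in `F`, the map `a ↦ P * a * P⁻¹` is a bijection from the set of
block matrices whose upper-left `n×n` block has trace `-1`, with zero last row and
column except the `(n+1,n+1)` entry equal to `1`, onto `sna(n,F)` (all row and column
sums equal `1` and trace `0`), and it preserves the affine commutator bracket. -/
theorem Pmat_conj_sna (F : Type*) [Field F] (n : ℕ) (hn : 0 < n)
    (hchar : ((n : F) + 1) ≠ 0) :
    Set.BijOn (fun a : Matrix (Fin (n + 1)) (Fin (n + 1)) F => Pmat F n * a * (Pmat F n)⁻¹)
      {a | a (Fin.last n) (Fin.last n) = 1 ∧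
           (∀ j, j ≠ Fin.last n → a (Fin.last n) j = 0 ∧ a j (Fin.last n) = 0) ∧
           ∑ k : Fin n, a (Fin.castSucc k) (Fin.castSucc k) = -1}
      {a | (∀ l, ∑ k, a l k = 1) ∧ (∀ l, ∑ k, a k l = 1) ∧ Matrix.trace a = 0} ∧
    ∀ a b : Matrix (Fin (n + 1)) (Fin (n + 1)) F,
      Pmat F n * (a * b - b * a + b) * (Pmat F n)⁻¹ =
        (Pmat F n * a * (Pmat F n)⁻¹) * (Pmat F n * b * (Pmat F n)⁻¹)
          - (Pmat F n * b * (Pmat F n)⁻¹) * (Pmat F n * a * (Pmat F n)⁻¹)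
          + Pmat F n * b * (Pmat F n)⁻¹ := by
  have hP := isUnit_Pmat_det F n hchar
  refine ⟨⟨fun a ha => ?_, fun a _ b _ hab => ?_, fun b hb => ?_⟩, fun a b => ?_⟩
  · exact (row_col_sums_eq_one_iff _).2
      ((Pmat_conj_fix_iff hchar a).2 ((block_iff_fix_single_last a).1 ha))
  · have hU := (Matrix.isUnit_iff_isUnit_det _).2 hP
    exact hU.mul_left_cancel ((Matrix.isUnit_nonsing_inv_iff.2 hU).mul_right_cancel hab)
  · have hconj : Pmat F n * ((Pmat F n)⁻¹ * b * Pmat F n) * (Pmat F n)⁻¹ = b := by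
      rw [Matrix.mul_assoc _ b, Matrix.mul_nonsing_inv_cancel_left _ _ hP,
        Matrix.mul_nonsing_inv_cancel_right _ _ hP]
    refine ⟨(Pmat F n)⁻¹ * b * Pmat F n, (block_iff_fix_single_last _).2
      ((Pmat_conj_fix_iff hchar _).1 ?_), hconj⟩
    rw [hconj]
    exact (row_col_sums_eq_one_iff b).1 hb
  · have hmul (x y : Matrix (Fin (n + 1)) (Fin (n + 1)) F) :
        (Pmat F n * x * (Pmat F n)⁻¹) * (Pmat F n * y * (Pmat F n)⁻¹)
          = Pmat F n * (x * y) * (Pmat F n)⁻¹ := by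
      simp only [Matrix.mul_assoc, Matrix.nonsing_inv_mul_cancel_left _ _ hP]
    rw [hmul, hmul]
    simp only [mul_add, mul_sub, add_mul, sub_mul]
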